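/- arXiv:1706.01131 — 11 statements merged into one kernel-verified Lean document; each statement's English description precedes it below -/
import Mathlib

section
/- For every integer T ≥ 1 and every real g ∈ (0,1], the function h_g attains its global maximum over ℝ^T at the price vector p* defined by p*_t = (T−t)·g/(2T−g(T−1)) + (T−g(T−1))/(2T−g(T−1)) for t = 1,…,T, and the maximum value is h_g(p*) = T/(4T−2g(T−1)). In particular the optimal price sequence is linearly increasing in time with increment g/(2T−g(T−1)). -/
/-- The seller's normalized limiting revenue under uniform network externality `g` over `T`
rounds, where `p t` is the price posted when `t` rounds remain (`p T` is the first-round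
price, `p 1` the last-round price):
`h_g(p) = (1/g)·[ Σ_{t=2}^{T} p_t (p_{t−1} − p_t) ] + (1/g)·p_1 (g + p_T(1−g) − p_1)`. -/
noncomputable def uniformRevenue (T : ℕ) (g : ℝ) (p : ℕ → ℝ) : ℝ :=
  (1 / g) * (∑ t ∈ Finset.Icc 2 T, p t * (p (t - 1) - p t))
    + (1 / g) * (p 1 * (g + p T * (1 - g) - p 1))

/-- Tangent-line bound for the telescoping sum. -/
lemma sum_bound (p : ℕ → ℝ) (c : ℝ) (n : ℕ) :
    ∑ t ∈ Finset.Icc 2 (n + 1), p t * (p (t - 1) - p t) ≤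
      (p 1 ^ 2 - p (n + 1) ^ 2 - 2 * c * (p 1 - p (n + 1)) + n * c ^ 2) / 2 := by
  induction n with
  | zero => simp
  | succ k ih =>
    rw [Finset.sum_Icc_succ_top (by omega)]
    simp only [Nat.add_sub_cancel]
    push_cast
    nlinarith [sq_nonneg (p (k + 1) - p (k + 1 + 1) - c)]

/-- Equality case of the bound for arithmetic progressions. -/
lemma sum_eq_of_step (p : ℕ → ℝ) (c : ℝ) (h : ∀ t, p t - p (t + 1) = c) (n : ℕ) :
    ∑ t ∈ Finset.Icc 2 (n + 1), p t * (p (t - 1) - p t) =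
      (p 1 ^ 2 - p (n + 1) ^ 2 - 2 * c * (p 1 - p (n + 1)) + n * c ^ 2) / 2 := by
  induction n with
  | zero => simp
  | succ k ih =>
    rw [Finset.sum_Icc_succ_top (by omega), ih]
    simp only [Nat.add_sub_cancel]
    push_cast
    have := h (k + 1)
    have h2 : p (k + 1) = p (k + 1 + 1) + c := by linarith
    rw [h2]
    ring

/-- For every integer `T ≥ 1` and every real `g ∈ (0,1]`, the revenue function `h_g` attains
its global maximum over ℝ^T at the price vector
`p*_t = (T−t)·g/(2T−g(T−1)) + (T−g(T−1))/(2T−g(T−1))`, `t = 1,…,T`, the maximum value is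
`T/(4T−2g(T−1))`, and the optimal price sequence is linearly increasing in time with
increment `g/(2T−g(T−1))`. -/
theorem uniform_externality_optimal_pricing
    (T : ℕ) (hT : 1 ≤ T) (g : ℝ) (hg0 : 0 < g) (hg1 : g ≤ 1)
    (pstar : ℕ → ℝ)
    (hpstar : ∀ t : ℕ, pstar t =
      ((T : ℝ) - t) * g / (2 * T - g * ((T : ℝ) - 1))
        + ((T : ℝ) - g * ((T : ℝ) - 1)) / (2 * T - g * ((T : ℝ) - 1))) :
    (∀ p : ℕ → ℝ, uniformRevenue T g p ≤ uniformRevenue T g pstar) ∧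
    uniformRevenue T g pstar = (T : ℝ) / (4 * T - 2 * g * ((T : ℝ) - 1)) ∧
    (∀ t : ℕ, 2 ≤ t → t ≤ T →
      pstar (t - 1) - pstar t = g / (2 * T - g * ((T : ℝ) - 1))) := by
  obtain ⟨n, rfl⟩ : ∃ n, T = n + 1 := ⟨T - 1, by omega⟩
  have hn : (0 : ℝ) ≤ n := Nat.cast_nonneg n
  have hD : (0 : ℝ) < 2 * (n + 1) - g * n := by nlinarith
  obtain ⟨D, hDdef⟩ : ∃ D : ℝ, D = 2 * (n + 1) - g * n := ⟨_, rfl⟩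
  rw [← hDdef] at hD
  have hD0 : D ≠ 0 := hD.ne'
  have e1 : 2 * ((n + 1 : ℕ) : ℝ) - g * (((n + 1 : ℕ) : ℝ) - 1) = D := by
    rw [hDdef]; push_cast; ring
  have e2 : 4 * ((n + 1 : ℕ) : ℝ) - 2 * g * (((n + 1 : ℕ) : ℝ) - 1) = 2 * D := by
    rw [hDdef]; push_cast; ring
  rw [e2]
  simp only [e1] at hpstar ⊢
  have hstep : ∀ t, pstar t - pstar (t + 1) = g / D := by
    intro t
    rw [hpstar, hpstar]
    push_cast
    field_simp
    ring
  have ha : pstar 1 = (n + 1) / D := by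
    rw [hpstar]; push_cast; field_simp; ring
  have hb : pstar (n + 1) = (n + 1 - g * n) / D := by
    rw [hpstar]; push_cast; field_simp; ring
  have hval : uniformRevenue (n + 1) g pstar = ((n + 1 : ℕ) : ℝ) / (2 * D) := by
    unfold uniformRevenue
    rw [sum_eq_of_step pstar (g / D) hstep n, ha, hb]
    push_cast
    field_simp
    rw [hDdef]
    ring
  refine ⟨?_, hval, ?_⟩
  · intro p
    rw [hval]
    unfold uniformRevenue
    rw [← mul_add, one_div, inv_mul_le_iff₀ hg0]
    have hs := sum_bound p (g / D) n
    have key : g * (((n + 1 : ℕ) : ℝ) / (2 * D)) -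
        ((p 1 ^ 2 - p (n + 1) ^ 2 - 2 * (g / D) * (p 1 - p (n + 1)) + n * (g / D) ^ 2) / 2
          + p 1 * (g + p (n + 1) * (1 - g) - p 1)) =
        ((1 - g) * ((p 1 - (n + 1) / D) - (p (n + 1) - (n + 1 - g * n) / D)) ^ 2
          + g * ((p 1 - (n + 1) / D) ^ 2 + (p (n + 1) - (n + 1 - g * n) / D) ^ 2)) / 2 := by
      push_cast
      field_simp
      rw [hDdef]
      ring
    have hpos : 0 ≤ ((1 - g) * ((p 1 - (n + 1) / D) - (p (n + 1) - (n + 1 - g * n) / D)) ^ 2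
          + g * ((p 1 - (n + 1) / D) ^ 2 + (p (n + 1) - (n + 1 - g * n) / D) ^ 2)) / 2 := by
      have : 0 ≤ 1 - g := by linarith
      positivity
    linarith
  · intro t ht _
    have := hstep (t - 1)
    rwa [Nat.sub_add_cancel (by omega)] at this
end

section
/- For every integer T ≥ 2 and every real g ∈ (0,1], the symmetric T×T real matrix M_g is negative definite; equivalently, for all nonzero x ∈ ℝ^T one has 2·Σ_{i=1}^{T−1} x_i x_{i+1} + 2(1−g) x_1 x_T − 2·Σ_{i=1}^T x_i² < 0. Consequently the uniform-externality revenue objective h_g is strictly concave on ℝ^T and its global maximizer is unique. -/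
/-- The symmetric `T×T` real matrix `M_g` (indices `0,…,T−1` standing for `1,…,T`):
the `(i,j)` entry is `−2` if `i = j`, plus `1` if `|i−j| = 1`, plus `(1−g)` if
`{i,j} = {1,T}`; contributions are added when several conditions hold (which matters
only for `T = 2`). -/
noncomputable def hessianMatrix (T : ℕ) (g : ℝ) : Matrix (Fin T) (Fin T) ℝ :=
  fun i j =>
    (if i = j then (-2 : ℝ) else 0)
    + (if i.val + 1 = j.val ∨ j.val + 1 = i.val then (1 : ℝ) else 0)
    + (if (i.val = 0 ∧ j.val = T - 1) ∨ (i.val = T - 1 ∧ j.val = 0)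
        then (1 - g : ℝ) else 0)

/-- The quadratic form as (minus) a sum of squares. -/
lemma quad_identity (x : ℕ → ℝ) (n : ℕ) :
    2 * (∑ i ∈ Finset.Icc 1 n, x i * x (i + 1)) - 2 * (∑ i ∈ Finset.Icc 1 (n + 1), (x i) ^ 2)
      = - (∑ i ∈ Finset.Icc 1 n, (x i - x (i + 1)) ^ 2) - x 1 ^ 2 - x (n + 1) ^ 2 := by
  induction n with
  | zero => simp; ring
  | succ k ih =>
    rw [Finset.sum_Icc_succ_top (by omega) (fun i => x i * x (i + 1)),
      Finset.sum_Icc_succ_top (by omega : 1 ≤ k + 1 + 1) (fun i => x i ^ 2),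
      Finset.sum_Icc_succ_top (by omega) (fun i => (x i - x (i + 1)) ^ 2)]
    linear_combination ih

lemma quad_neg (x : ℕ → ℝ) (n : ℕ) (g : ℝ) (hg0 : 0 < g) (hg1 : g ≤ 1)
    (hx : ∃ i, 1 ≤ i ∧ i ≤ n + 1 ∧ x i ≠ 0) :
    2 * (∑ i ∈ Finset.Icc 1 n, x i * x (i + 1))
        + 2 * (1 - g) * (x 1 * x (n + 1))
        - 2 * (∑ i ∈ Finset.Icc 1 (n + 1), (x i) ^ 2) < 0 := by
  by_contra hcon
  push Not at hcon
  have hid := quad_identity x n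
  have hS : 0 ≤ ∑ i ∈ Finset.Icc 1 n, (x i - x (i + 1)) ^ 2 :=
    Finset.sum_nonneg fun i _ => sq_nonneg _
  have h1 : 0 ≤ (1 - g) * (x 1 - x (n + 1)) ^ 2 := mul_nonneg (by linarith) (sq_nonneg _)
  have h2 : 0 ≤ g * x 1 ^ 2 := by positivity
  have h3 : 0 ≤ g * x (n + 1) ^ 2 := by positivity
  have hS0 : ∑ i ∈ Finset.Icc 1 n, (x i - x (i + 1)) ^ 2 = 0 := by nlinarith
  have hx1 : g * x 1 ^ 2 = 0 := by nlinarith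
  have hx10 : x 1 = 0 := by
    rcases mul_eq_zero.1 hx1 with h | h
    · linarith
    · exact pow_eq_zero_iff (two_ne_zero) |>.1 h
  rw [Finset.sum_eq_zero_iff_of_nonneg (fun i _ => sq_nonneg _)] at hS0
  have hall : ∀ k, k ≤ n → x (k + 1) = 0 := by
    intro k
    induction k with
    | zero => intro _; exact hx10
    | succ k ih =>
      intro hk
      have h := hS0 (k + 1) (Finset.mem_Icc.2 ⟨by omega, hk⟩)
      have h' := (pow_eq_zero_iff (two_ne_zero)).1 h
      rw [ih (by omega)] at h'
      linarith
  obtain ⟨i, hi1, hi2, hi⟩ := hx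
  obtain ⟨k, rfl⟩ : ∃ k, i = k + 1 := ⟨i - 1, by omega⟩
  exact hi (hall k (by omega))

lemma revenue_eq (n : ℕ) (g : ℝ) (hg : 0 < g) (p : ℕ → ℝ) :
    uniformRevenue (n + 1) g p = p 1 + (1 / g) * (1 / 2) *
      (2 * (1 - g) * (p 1 * p (n + 1))
        - (∑ i ∈ Finset.Icc 1 n, (p i - p (i + 1)) ^ 2) - p 1 ^ 2 - p (n + 1) ^ 2) := by
  have key : ∑ t ∈ Finset.Icc 2 (n + 1), p t * (p (t - 1) - p t)
      = - (1 / 2) * (∑ i ∈ Finset.Icc 1 n, (p i - p (i + 1)) ^ 2)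
        + (1 / 2) * (p 1 ^ 2 - p (n + 1) ^ 2) := by
    induction n with
    | zero => simp
    | succ k ih =>
      rw [Finset.sum_Icc_succ_top (by omega : 2 ≤ k + 1 + 1), ih,
        Finset.sum_Icc_succ_top (by omega) (fun i => (p i - p (i + 1)) ^ 2)]
      simp only [Nat.add_sub_cancel]
      ring
  unfold uniformRevenue
  rw [key]
  field_simp
  ring

lemma revenue_convex_comb (n : ℕ) (g : ℝ) (hg : 0 < g) (p q : ℕ → ℝ) (a b : ℝ)
    (hab : a + b = 1) :
    uniformRevenue (n + 1) g (a • p + b • q)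
      = a * uniformRevenue (n + 1) g p + b * uniformRevenue (n + 1) g q
        - a * b * ((1 / g) * (1 / 2)) *
          (2 * (∑ i ∈ Finset.Icc 1 n, (p - q) i * (p - q) (i + 1))
            + 2 * (1 - g) * ((p - q) 1 * (p - q) (n + 1))
            - 2 * (∑ i ∈ Finset.Icc 1 (n + 1), ((p - q) i) ^ 2)) := by
  have hS : ∑ i ∈ Finset.Icc 1 n, ((a • p + b • q) i - (a • p + b • q) (i + 1)) ^ 2
      = a * (∑ i ∈ Finset.Icc 1 n, (p i - p (i + 1)) ^ 2)
        + b * (∑ i ∈ Finset.Icc 1 n, (q i - q (i + 1)) ^ 2)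
        - a * b * (∑ i ∈ Finset.Icc 1 n, ((p - q) i - (p - q) (i + 1)) ^ 2) := by
    rw [Finset.mul_sum, Finset.mul_sum, Finset.mul_sum, ← Finset.sum_add_distrib,
      ← Finset.sum_sub_distrib]
    refine Finset.sum_congr rfl fun i _ => ?_
    obtain rfl : b = 1 - a := by linarith
    simp only [Pi.add_apply, Pi.smul_apply, Pi.sub_apply, smul_eq_mul]
    ring
  have hid := quad_identity (p - q) n
  rw [add_sub_right_comm (2 * ∑ i ∈ Finset.Icc 1 n, (p - q) i * (p - q) (i + 1)), hid,
    revenue_eq n g hg, revenue_eq n g hg, revenue_eq n g hg, hS]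
  obtain rfl : b = 1 - a := by linarith
  simp only [Pi.add_apply, Pi.smul_apply, Pi.sub_apply, smul_eq_mul]
  ring

lemma revenue_strict (n : ℕ) (g : ℝ) (hg0 : 0 < g) (hg1 : g ≤ 1) (p q : ℕ → ℝ)
    (h : ∃ i, 1 ≤ i ∧ i ≤ n + 1 ∧ p i ≠ q i) (a b : ℝ) (ha : 0 < a) (hb : 0 < b)
    (hab : a + b = 1) :
    a * uniformRevenue (n + 1) g p + b * uniformRevenue (n + 1) g q
      < uniformRevenue (n + 1) g (a • p + b • q) := by
  rw [revenue_convex_comb n g hg0 p q a b hab]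
  have hq := quad_neg (p - q) n g hg0 hg1 (by
    obtain ⟨i, h1, h2, h3⟩ := h
    exact ⟨i, h1, h2, by simpa [sub_eq_zero] using h3⟩)
  have hc : 0 < a * b * ((1 / g) * (1 / 2)) := by positivity
  have := mul_neg_of_pos_of_neg hc hq
  linarith

/-- The double sum of the Hessian form. -/
lemma double_sum (n : ℕ) (hn : 1 ≤ n) (g : ℝ) (y : ℕ → ℝ) :
    ∑ i ∈ Finset.range (n + 1), ∑ j ∈ Finset.range (n + 1), y i *
      (((if i = j then (-2 : ℝ) else 0)
      + (if i + 1 = j ∨ j + 1 = i then (1 : ℝ) else 0)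
      + (if (i = 0 ∧ j = n) ∨ (i = n ∧ j = 0) then (1 - g : ℝ) else 0)) * y j)
    = 2 * (∑ i ∈ Finset.range n, y i * y (i + 1)) + 2 * (1 - g) * (y 0 * y n)
      - 2 * ∑ i ∈ Finset.range (n + 1), y i ^ 2 := by
  have hsplit : ∀ i j : ℕ, y i *
      (((if i = j then (-2 : ℝ) else 0)
      + (if i + 1 = j ∨ j + 1 = i then (1 : ℝ) else 0)
      + (if (i = 0 ∧ j = n) ∨ (i = n ∧ j = 0) then (1 - g : ℝ) else 0)) * y j)
      = (if i = j then -2 * (y i * y j) else 0)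
        + (if i + 1 = j then y i * y j else 0) + (if j + 1 = i then y i * y j else 0)
        + (if i = 0 then (if j = n then (1 - g) * (y i * y j) else 0) else 0)
        + (if i = n then (if j = 0 then (1 - g) * (y i * y j) else 0) else 0) := by
    intro i j
    have e1 : (if i + 1 = j ∨ j + 1 = i then (1 : ℝ) else 0)
        = (if i + 1 = j then 1 else 0) + (if j + 1 = i then 1 else 0) := by
      split_ifs <;> first | omega | simp
    have e2 : (if (i = 0 ∧ j = n) ∨ (i = n ∧ j = 0) then (1 - g : ℝ) else 0)
        = (if i = 0 then (if j = n then 1 - g else 0) else 0)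
          + (if i = n then (if j = 0 then 1 - g else 0) else 0) := by
      split_ifs <;> first | omega | simp
    rw [e1, e2]
    simp only [add_mul, mul_add, ite_mul, mul_ite, zero_mul, mul_zero, one_mul]
    have c1 : y i * (-2 * y j) = -2 * (y i * y j) := by ring
    have c2 : y i * ((1 - g) * y j) = (1 - g) * (y i * y j) := by ring
    rw [c1, c2]
    ring
  have hup : ∑ i ∈ Finset.range (n + 1), ∑ j ∈ Finset.range (n + 1),
      (if i + 1 = j then y i * y j else 0) = ∑ i ∈ Finset.range n, y i * y (i + 1) := by
    rw [Finset.sum_range_succ]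
    have hz : ∑ j ∈ Finset.range (n + 1), (if n + 1 = j then y n * y j else 0) = 0 := by
      simp
    rw [hz, add_zero]
    refine Finset.sum_congr rfl fun i hi => ?_
    rw [Finset.sum_ite_eq, if_pos]
    simp at hi ⊢
    omega
  have hdown : ∑ i ∈ Finset.range (n + 1), ∑ j ∈ Finset.range (n + 1),
      (if j + 1 = i then y i * y j else 0) = ∑ i ∈ Finset.range n, y i * y (i + 1) := by
    rw [Finset.sum_comm, ← hup]
    refine Finset.sum_congr rfl fun i _ => Finset.sum_congr rfl fun j _ => ?_
    rw [mul_comm]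
  have hdiag : ∑ i ∈ Finset.range (n + 1), ∑ j ∈ Finset.range (n + 1),
      (if i = j then -2 * (y i * y j) else 0) = -2 * ∑ i ∈ Finset.range (n + 1), y i ^ 2 := by
    rw [Finset.mul_sum]
    refine Finset.sum_congr rfl fun i hi => ?_
    rw [Finset.sum_ite_eq, if_pos hi]
    ring
  have hc1 : ∑ i ∈ Finset.range (n + 1), ∑ j ∈ Finset.range (n + 1),
      (if i = 0 then (if j = n then (1 - g) * (y i * y j) else 0) else 0)
      = (1 - g) * (y 0 * y n) := by
    rw [Finset.sum_eq_single 0, Finset.sum_eq_single n] <;> simp +contextual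
  have hc2 : ∑ i ∈ Finset.range (n + 1), ∑ j ∈ Finset.range (n + 1),
      (if i = n then (if j = 0 then (1 - g) * (y i * y j) else 0) else 0)
      = (1 - g) * (y 0 * y n) := by
    rw [Finset.sum_eq_single n, Finset.sum_eq_single 0] <;> simp +contextual [mul_comm]
  simp only [hsplit, Finset.sum_add_distrib]
  rw [hup, hdown, hdiag, hc1, hc2]
  ring

lemma hessian_posDef (n : ℕ) (hn : 1 ≤ n) (g : ℝ) (hg0 : 0 < g) (hg1 : g ≤ 1) :
    (-(hessianMatrix (n + 1) g)).PosDef := by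
  refine Matrix.PosDef.of_dotProduct_mulVec_pos ?_ ?_
  · ext i j
    simp only [Matrix.conjTranspose_apply, Matrix.neg_apply, hessianMatrix, star_trivial]
    have e1 : (i = j) = (j = i) := propext eq_comm
    have e2 : (i.val + 1 = j.val ∨ j.val + 1 = i.val)
      = (j.val + 1 = i.val ∨ i.val + 1 = j.val) := propext or_comm
    have e3 : ((i.val = 0 ∧ j.val = n + 1 - 1) ∨ (i.val = n + 1 - 1 ∧ j.val = 0))
      = ((j.val = 0 ∧ i.val = n + 1 - 1) ∨ (j.val = n + 1 - 1 ∧ i.val = 0)) :=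
      propext (by tauto)
    simp only [e1, e2, e3]
  · intro x hx
    let y : ℕ → ℝ := fun k => if h : k < n + 1 then x ⟨k, h⟩ else 0
    have hy : ∀ i : Fin (n + 1), x i = y i.val := fun i => by simp only [y, dif_pos i.isLt]
    have hq := quad_neg (fun k => y (k - 1)) n g hg0 hg1 (by
      obtain ⟨i, hi⟩ := Function.ne_iff.1 hx
      exact ⟨i.val + 1, by omega, by omega, by simpa [← hy] using hi⟩)
    have hd := double_sum n hn g y
    have s1 : ∑ i ∈ Finset.Icc 1 n, y (i - 1) * y (i + 1 - 1)
        = ∑ i ∈ Finset.range n, y i * y (i + 1) := by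
      rw [Finset.sum_bij' (fun i _ => i - 1) (fun i _ => i + 1)] <;>
        simp +contextual <;> (intros; first | omega | skip)
    have s2 : ∑ i ∈ Finset.Icc 1 (n + 1), y (i - 1) ^ 2
        = ∑ i ∈ Finset.range (n + 1), y i ^ 2 := by
      rw [Finset.sum_bij' (fun i _ => i - 1) (fun i _ => i + 1)] <;>
        simp +contextual <;> (intros; first | omega | skip)
    simp only [s1, s2] at hq
    simp only [Nat.sub_self, Nat.add_sub_cancel] at hq
    have hform : star x ⬝ᵥ ((-(hessianMatrix (n + 1) g)).mulVec x)
        = - ∑ i ∈ Finset.range (n + 1), ∑ j ∈ Finset.range (n + 1), y i *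
      (((if i = j then (-2 : ℝ) else 0)
      + (if i + 1 = j ∨ j + 1 = i then (1 : ℝ) else 0)
      + (if (i = 0 ∧ j = n) ∨ (i = n ∧ j = 0) then (1 - g : ℝ) else 0)) * y j) := by
      simp only [Finset.sum_range, dotProduct, Matrix.mulVec, Matrix.neg_apply, hessianMatrix,
        Pi.star_apply, star_trivial, Finset.mul_sum, ← Finset.sum_neg_distrib, Nat.add_sub_cancel]
      refine Finset.sum_congr rfl fun i _ => Finset.sum_congr rfl fun j _ => ?_
      rw [hy i, hy j]
      simp only [Fin.ext_iff]
      ring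
    rw [hform, hd]
    linarith

/-- For every integer `T ≥ 2` and every real `g ∈ (0,1]`, the matrix `M_g` is negative
definite; equivalently, for all nonzero `x ∈ ℝ^T`,
`2·Σ_{i=1}^{T−1} x_i x_{i+1} + 2(1−g) x_1 x_T − 2·Σ_{i=1}^T x_i² < 0`.
Consequently `h_g` is strictly concave on ℝ^T and its global maximizer is unique. -/
theorem hessian_neg_def_strict_concave
    (T : ℕ) (hT : 2 ≤ T) (g : ℝ) (hg0 : 0 < g) (hg1 : g ≤ 1) :
    (-(hessianMatrix T g)).PosDef ∧
    (∀ x : ℕ → ℝ, (∃ i, 1 ≤ i ∧ i ≤ T ∧ x i ≠ 0) →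
      2 * (∑ i ∈ Finset.Icc 1 (T - 1), x i * x (i + 1))
        + 2 * (1 - g) * (x 1 * x T)
        - 2 * (∑ i ∈ Finset.Icc 1 T, (x i) ^ 2) < 0) ∧
    (∀ p q : ℕ → ℝ, (∃ i, 1 ≤ i ∧ i ≤ T ∧ p i ≠ q i) →
      ∀ a b : ℝ, 0 < a → 0 < b → a + b = 1 →
        a * uniformRevenue T g p + b * uniformRevenue T g q
          < uniformRevenue T g (a • p + b • q)) ∧
    (∀ p q : ℕ → ℝ,
      (∀ r : ℕ → ℝ, uniformRevenue T g r ≤ uniformRevenue T g p) →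
      (∀ r : ℕ → ℝ, uniformRevenue T g r ≤ uniformRevenue T g q) →
      ∀ i : ℕ, 1 ≤ i → i ≤ T → p i = q i) := by
  obtain ⟨n, rfl⟩ : ∃ n, T = n + 1 := ⟨T - 1, by omega⟩
  refine ⟨hessian_posDef n (by omega) g hg0 hg1, fun x hx => ?_, ?_, ?_⟩
  · simpa only [Nat.add_sub_cancel] using quad_neg x n g hg0 hg1 hx
  · intro p q h a b ha hb hab
    exact revenue_strict n g hg0 hg1 p q h a b ha hb hab
  · intro p q hp hq i h1 h2
    by_contra hne
    have h := revenue_strict n g hg0 hg1 p q ⟨i, h1, h2, hne⟩ (1 / 2) (1 / 2)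
      (by norm_num) (by norm_num) (by norm_num)
    have h3 := hp ((1 / 2 : ℝ) • p + (1 / 2 : ℝ) • q)
    have h4 := hq ((1 / 2 : ℝ) • p + (1 / 2 : ℝ) • q)
    linarith
end

section
/- Let m ≥ 1 be an integer, let E be an invertible m×m real matrix, set κ = 𝟏ᵀ E^{−1} 𝟏 (the sum of all entries of E^{−1}), and assume κ ≥ 1. For every integer T ≥ 1, the function h(p_T,…,p_1) = Σ_{t=2}^{T} κ p_t (p_{t−1} − p_t) + p_1 (1 − κ p_1 + p_T (κ − 1)) attains its global maximum over ℝ^T at the price vector p*_t = (T−t)/(2Tκ − (T−1)) + (Tκ − (T−1))/(2Tκ − (T−1)) for t = 1,…,T, and the maximum value equals κT/(4Tκ − 2(T−1)). In particular the optimal price sequence is linearly increasing in time with increment 1/(2Tκ − (T−1)). -/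
/-- The seller's normalized limiting revenue for a block-model externality matrix with
`κ = 𝟏ᵀ E⁻¹ 𝟏`, where `p t` is the price posted when `t` rounds remain:
`h(p_T,…,p_1) = Σ_{t=2}^{T} κ p_t (p_{t−1} − p_t) + p_1 (1 − κ p_1 + p_T (κ − 1))`. -/
noncomputable def blockRevenue (T : ℕ) (κ : ℝ) (p : ℕ → ℝ) : ℝ :=
  (∑ t ∈ Finset.Icc 2 T, κ * p t * (p (t - 1) - p t))
    + p 1 * (1 - κ * p 1 + p T * (κ - 1))

lemma sum_le_aux (κ c : ℝ) (hκ : 0 ≤ κ) (p : ℕ → ℝ) (n : ℕ) :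
    (∑ t ∈ Finset.Icc 2 (n + 1), κ * p t * (p (t - 1) - p t)) ≤
      κ / 2 * (p 1 ^ 2 - p (n + 1) ^ 2 - 2 * c * (p 1 - p (n + 1)) + n * c ^ 2) := by
  induction n with
  | zero => simp
  | succ k ih =>
    rw [Finset.sum_Icc_succ_top (by omega)]
    simp only [Nat.add_sub_cancel]
    push_cast
    nlinarith [mul_nonneg hκ (sq_nonneg (p (k + 1) - p (k + 1 + 1) - c))]

lemma sum_eq_aux (κ c : ℝ) (p : ℕ → ℝ) (hp : ∀ t, p t = p (t + 1) + c) (n : ℕ) :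
    (∑ t ∈ Finset.Icc 2 (n + 1), κ * p t * (p (t - 1) - p t)) =
      κ / 2 * (p 1 ^ 2 - p (n + 1) ^ 2 - 2 * c * (p 1 - p (n + 1)) + n * c ^ 2) := by
  induction n with
  | zero => simp
  | succ k ih =>
    rw [Finset.sum_Icc_succ_top (by omega), ih]
    simp only [Nat.add_sub_cancel]
    rw [hp (k + 1)]
    push_cast
    ring

/-- Let `E` be an invertible `m×m` real matrix, `κ = 𝟏ᵀ E⁻¹ 𝟏 ≥ 1` the sum of the entries
of `E⁻¹`.  For every `T ≥ 1`, the revenue `h` attains its global maximum over ℝ^T at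
`p*_t = (T−t)/(2Tκ − (T−1)) + (Tκ − (T−1))/(2Tκ − (T−1))`, the maximum value equals
`κT/(4Tκ − 2(T−1))`, and the optimal price sequence is linearly increasing in time with
increment `1/(2Tκ − (T−1))`. -/
theorem block_model_optimal_pricing
    (m : ℕ) (hm : 1 ≤ m) (E : Matrix (Fin m) (Fin m) ℝ) (hE : IsUnit E.det)
    (κ : ℝ) (hκdef : κ = ∑ i, ∑ j, E⁻¹ i j) (hκ : 1 ≤ κ)
    (T : ℕ) (hT : 1 ≤ T) (pstar : ℕ → ℝ)
    (hpstar : ∀ t : ℕ, pstar t =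
      ((T : ℝ) - t) / (2 * T * κ - ((T : ℝ) - 1))
        + ((T : ℝ) * κ - ((T : ℝ) - 1)) / (2 * T * κ - ((T : ℝ) - 1))) :
    (∀ p : ℕ → ℝ, blockRevenue T κ p ≤ blockRevenue T κ pstar) ∧
    blockRevenue T κ pstar = κ * T / (4 * T * κ - 2 * ((T : ℝ) - 1)) ∧
    (∀ t : ℕ, 2 ≤ t → t ≤ T →
      pstar (t - 1) - pstar t = 1 / (2 * T * κ - ((T : ℝ) - 1))) := by
  obtain ⟨n, rfl⟩ : ∃ n, T = n + 1 := ⟨T - 1, by omega⟩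
  have hn : (0 : ℝ) ≤ n := Nat.cast_nonneg n
  push_cast at hpstar ⊢
  have hD : 0 < 2 * ((n : ℝ) + 1) * κ - ((n : ℝ) + 1 - 1) := by nlinarith
  have hD2 : 4 * ((n : ℝ) + 1) * κ - 2 * ((n : ℝ) + 1 - 1) =
      2 * (2 * ((n : ℝ) + 1) * κ - ((n : ℝ) + 1 - 1)) := by ring
  rw [hD2]
  obtain ⟨D, hDdef⟩ : ∃ D, D = 2 * ((n : ℝ) + 1) * κ - ((n : ℝ) + 1 - 1) := ⟨_, rfl⟩
  rw [← hDdef] at hD hpstar ⊢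
  have hD0 : D ≠ 0 := hD.ne'
  have hstep : ∀ t, pstar t = pstar (t + 1) + 1 / D := by
    intro t
    rw [hpstar, hpstar]
    push_cast
    field_simp
    ring
  have hval : blockRevenue (n + 1) κ pstar = κ * ((n : ℝ) + 1) / (2 * D) := by
    unfold blockRevenue
    rw [sum_eq_aux κ (1 / D) pstar hstep n, hpstar 1, hpstar (n + 1)]
    push_cast
    field_simp
    rw [hDdef]
    ring
  refine ⟨?_, hval, ?_⟩
  · intro p
    rw [hval]
    obtain ⟨c, hc⟩ : ∃ c : ℝ, p (n + 1) = p 1 - n * c := by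
      rcases Nat.eq_zero_or_pos n with h | h
      · subst h
        exact ⟨0, by simp⟩
      · have : (n : ℝ) ≠ 0 := by positivity
        exact ⟨(p 1 - p (n + 1)) / n, by field_simp; ring⟩
    have h1 := sum_le_aux κ c (by linarith) p n
    unfold blockRevenue
    rw [hc] at h1 ⊢
    have key : κ * ((n : ℝ) + 1) / (2 * D) =
        κ / 2 * (p 1 ^ 2 - (p 1 - n * c) ^ 2 - 2 * c * (p 1 - (p 1 - n * c)) + n * c ^ 2)
        + p 1 * (1 - κ * p 1 + (p 1 - n * c) * (κ - 1))
        + (p 1 - (1 + n * c) / 2) ^ 2 + n * D / 4 * (c - 1 / D) ^ 2 := by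
      have hk : κ = (D + n) / (2 * ((n : ℝ) + 1)) := by
        rw [hDdef]; field_simp; ring
      rw [hk]
      field_simp
      ring
    have h2 : 0 ≤ n * D / 4 * (c - 1 / D) ^ 2 := by positivity
    have h3 := sq_nonneg (p 1 - (1 + n * c) / 2)
    linarith
  · intro t ht _
    obtain ⟨s, rfl⟩ : ∃ s, t = s + 1 := ⟨t - 1, by omega⟩
    simp only [Nat.add_sub_cancel]
    rw [hstep s]
    ring
end

section
/- Let m ≥ 1 and T ≥ 1 be integers, let E be an invertible m×m real matrix with E^{−1}𝟏 ≥ 0 entrywise and κ = 𝟏ᵀ E^{−1} 𝟏 ≥ 1, and let A = diag(α_1,…,α_m) with all α_i > 0. Set D = 2Tκ − (T−1) and define prices p_t = (T−t)/D + (Tκ − (T−1))/D for t = 1,…,T, and threshold vectors in ℝ^m: v_{T+1} = 𝟏, v_t = 𝟏 − ((T+1−t)/D)·(EA)^{−1}𝟏 for t = 2,…,T, and v_1 = ((Tκ − (T−1))/D)·𝟏. Then: (i) EA(v_{t+1} − v_t) = (p_{t−1} − p_t)·𝟏 for every t = 2,…,T; (ii) v_1 − p_1·𝟏 + EA(𝟏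 − v_2) = 0; (iii) v_2 ≤ v_3 ≤ … ≤ v_{T+1} entrywise and v_1 ≥ 0 entrywise. -/
open Matrix

/-- In the block-model dynamic pricing game with `m` groups of relative sizes `α i > 0`
(`A = diag α`), invertible externality matrix `E` with `E⁻¹𝟏 ≥ 0` and
`κ = 𝟏ᵀ E⁻¹ 𝟏 ≥ 1`, set `D = 2Tκ − (T−1)`, prices
`p_t = (T−t)/D + (Tκ − (T−1))/D`, and thresholds `v_{T+1} = 𝟏`,
`v_t = 𝟏 − ((T+1−t)/D)·(EA)⁻¹𝟏` for `t = 2,…,T`, `v_1 = ((Tκ − (T−1))/D)·𝟏`.  Then: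
(i) `EA(v_{t+1} − v_t) = (p_{t−1} − p_t)𝟏` for `t = 2,…,T`;
(ii) `v_1 − p_1 𝟏 + EA(𝟏 − v_2) = 0`;
(iii) `v_2 ≤ v_3 ≤ … ≤ v_{T+1}` entrywise and `v_1 ≥ 0` entrywise. -/
theorem block_model_thresholds
    (m T : ℕ) (hm : 1 ≤ m) (hT : 1 ≤ T)
    (E : Matrix (Fin m) (Fin m) ℝ) (hE : IsUnit E.det)
    (hEinv1 : ∀ i, 0 ≤ (E⁻¹ *ᵥ (1 : Fin m → ℝ)) i)
    (κ : ℝ) (hκdef : κ = ∑ i, ∑ j, E⁻¹ i j) (hκ : 1 ≤ κ)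
    (α : Fin m → ℝ) (hα : ∀ i, 0 < α i)
    (A : Matrix (Fin m) (Fin m) ℝ) (hA : A = Matrix.diagonal α)
    (D : ℝ) (hD : D = 2 * T * κ - ((T : ℝ) - 1))
    (p : ℕ → ℝ)
    (hp : ∀ t : ℕ, p t = ((T : ℝ) - t) / D + ((T : ℝ) * κ - ((T : ℝ) - 1)) / D)
    (v : ℕ → Fin m → ℝ)
    (hvT1 : v (T + 1) = 1)
    (hvt : ∀ t : ℕ, 2 ≤ t → t ≤ T →
      v t = (1 : Fin m → ℝ) - (((T : ℝ) + 1 - t) / D) • ((E * A)⁻¹ *ᵥ (1 : Fin m → ℝ)))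
    (hv1 : v 1 = (((T : ℝ) * κ - ((T : ℝ) - 1)) / D) • (1 : Fin m → ℝ)) :
    (∀ t : ℕ, 2 ≤ t → t ≤ T →
      (E * A) *ᵥ (v (t + 1) - v t) = (p (t - 1) - p t) • (1 : Fin m → ℝ)) ∧
    (v 1 - p 1 • (1 : Fin m → ℝ) + (E * A) *ᵥ ((1 : Fin m → ℝ) - v 2) = 0) ∧
    (∀ t : ℕ, 2 ≤ t → t ≤ T → ∀ i, v t i ≤ v (t + 1) i) ∧
    (∀ i, 0 ≤ v 1 i) := by
  have hTr : (1 : ℝ) ≤ (T : ℝ) := by exact_mod_cast hT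
  have hTκ : (T : ℝ) ≤ T * κ := by nlinarith
  have hDpos : 0 < D := by rw [hD]; nlinarith
  have hdetA : IsUnit A.det := by
    rw [hA, Matrix.det_diagonal, isUnit_iff_ne_zero]
    exact (Finset.prod_pos fun i _ => hα i).ne'
  have hdet : IsUnit (E * A).det := by
    rw [Matrix.det_mul]; exact hE.mul hdetA
  obtain ⟨w, hw⟩ : ∃ w, w = (E * A)⁻¹ *ᵥ (1 : Fin m → ℝ) := ⟨_, rfl⟩
  have hEw : (E * A) *ᵥ w = 1 := by
    rw [hw, Matrix.mulVec_mulVec, Matrix.mul_nonsing_inv _ hdet, Matrix.one_mulVec]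
  have hAw : A *ᵥ w = E⁻¹ *ᵥ (1 : Fin m → ℝ) := by
    rw [← hEw, Matrix.mulVec_mulVec, ← Matrix.mul_assoc, Matrix.nonsing_inv_mul _ hE,
      Matrix.one_mul]
  have hw0 : ∀ i, 0 ≤ w i := by
    intro i
    have h := hEinv1 i
    rw [← hAw, hA, Matrix.mulVec_diagonal] at h
    exact nonneg_of_mul_nonneg_right h (hα i)
  have hv : ∀ t : ℕ, 2 ≤ t → t ≤ T + 1 →
      v t = (1 : Fin m → ℝ) - (((T : ℝ) + 1 - t) / D) • w := by
    intro t h2 ht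
    rcases Nat.lt_or_ge T t with h | h
    · obtain rfl : t = T + 1 := by omega
      rw [hvT1]; simp
    · rw [hvt t h2 h, hw]
  have hdiff : ∀ t : ℕ, 2 ≤ t → t ≤ T → v (t + 1) - v t = (1 / D) • w := by
    intro t h2 ht
    rw [hv t h2 (by omega), hv (t + 1) (by omega) (by omega)]
    ext i
    simp only [Pi.sub_apply, Pi.smul_apply, smul_eq_mul]
    push_cast
    ring
  refine ⟨?_, ?_, ?_, ?_⟩
  · intro t h2 ht
    rw [hdiff t h2 ht, Matrix.mulVec_smul, hEw, hp, hp, Nat.cast_sub (by omega)]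
    congr 1
    push_cast
    ring
  · have h2 : (1 : Fin m → ℝ) - v 2 = (((T : ℝ) - 1) / D) • w := by
      rw [hv 2 le_rfl (by omega)]
      ext i
      simp only [Pi.sub_apply, Pi.smul_apply, smul_eq_mul]
      push_cast
      ring
    rw [h2, Matrix.mulVec_smul, hEw, hv1, hp]
    ext i
    simp only [Pi.sub_apply, Pi.add_apply, Pi.smul_apply, smul_eq_mul, Pi.zero_apply]
    push_cast
    ring
  · intro t h2 ht i
    have h := congrFun (hdiff t h2 ht) i
    simp only [Pi.sub_apply, Pi.smul_apply, smul_eq_mul] at h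
    have : 0 ≤ 1 / D * w i := mul_nonneg (by positivity) (hw0 i)
    linarith
  · intro i
    rw [hv1]
    simp only [Pi.smul_apply, smul_eq_mul, Pi.one_apply, mul_one]
    exact div_nonneg (by linarith) hDpos.le
end

section
/- Define W(T,κ) = Tκ·(3Tκ − (T−1)) / (2·(2Tκ − (T−1))²) for real T ≥ 1 and κ ≥ 1. Then W is nondecreasing in T on [1,∞) for every fixed κ ≥ 1, and nonincreasing in κ on [1,∞) for every fixed T ≥ 1 (equivalently, nondecreasing in the network effect 1/κ). -/
theorem welfare_aux (a b s t : ℝ) (ha : 0 < a) (hb : 0 < b) (hs : s ≤ a) (ht : t ≤ b)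
    (h : s * b ≤ t * a) :
    a * (3 * a - s) / (2 * (2 * a - s) ^ 2) ≤ b * (3 * b - t) / (2 * (2 * b - t) ^ 2) := by
  obtain ⟨u, hu⟩ : ∃ u, u = 2 * a - s := ⟨_, rfl⟩
  obtain ⟨v, hv⟩ : ∃ v, v = 2 * b - t := ⟨_, rfl⟩
  have hu0 : 0 < u := by linarith
  have hv0 : 0 < v := by linarith
  have e1 : 3 * a - s = a + u := by linarith
  have e2 : 3 * b - t = b + v := by linarith
  rw [← hu, ← hv, e1, e2, div_le_div_iff₀ (by positivity) (by positivity)]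
  have hk : a * v ≤ b * u := by subst hu hv; nlinarith
  have h1 : (a * v) ^ 2 ≤ (b * u) ^ 2 := by gcongr
  have h2 : (a * v) * (u * v) ≤ (b * u) * (u * v) := by gcongr
  nlinarith

/-- `W(T,κ) = Tκ·(3Tκ − (T−1)) / (2·(2Tκ − (T−1))²)` is the normalized limiting social
welfare under the optimal committed price sequence in the `T`-round game with
`κ = 𝟏ᵀE⁻¹𝟏 ≥ 1` (so `1/κ` is the network effect).  `W` is nondecreasing in `T` on `[1,∞)`
for every fixed `κ ≥ 1`, and nonincreasing in `κ` on `[1,∞)` for every fixed `T ≥ 1`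
(equivalently, nondecreasing in the network effect `1/κ`). -/
theorem welfare_monotone :
    (∀ κ : ℝ, 1 ≤ κ →
      MonotoneOn (fun T : ℝ =>
        T * κ * (3 * T * κ - (T - 1)) / (2 * (2 * T * κ - (T - 1)) ^ 2)) (Set.Ici 1)) ∧
    (∀ T : ℝ, 1 ≤ T →
      AntitoneOn (fun κ : ℝ =>
        T * κ * (3 * T * κ - (T - 1)) / (2 * (2 * T * κ - (T - 1)) ^ 2)) (Set.Ici 1)) := by
  refine ⟨fun κ hκ x hx y hy hxy => ?_, fun T hT x hx y hy hxy => ?_⟩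
  · simp only [Set.mem_Ici] at hx hy
    have := welfare_aux (x * κ) (y * κ) (x - 1) (y - 1) (by positivity) (by positivity)
      (by nlinarith) (by nlinarith) (by nlinarith)
    simpa only [mul_assoc] using this
  · simp only [Set.mem_Ici] at hx hy
    have := welfare_aux (T * y) (T * x) (T - 1) (T - 1) (by positivity) (by positivity)
      (by nlinarith) (by nlinarith) (by gcongr)
    simpa only [mul_assoc] using this
end

section
/- Let k ≥ 1 and let Δ = {x ∈ ℝ^k : x_i ≥ 0 for all i and Σ_{i=1}^k x_i ≤ 1} be the k-dimensional simplex, and let f : Δ → ℝ be continuous. For each positive integer n define B_{f,n}(x) = Σ_{r ∈ ℕ^k, Σ r_i ≤ n} f(r_1/n,…,r_k/n) · (n! / (r_1!⋯r_k!(n − r_1 − ⋯ − r_k)!)) · x_1^{r_1}⋯x_k^{r_k} (1 − x_1 − ⋯ − x_k)^{n − r_1 − ⋯ − r_k}. Then for every x ∈ Δ, B_{f,n}(x) → f(x) as n → ∞. -/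
/-- The Bernstein polynomial on the `k`-dimensional simplex associated with `f` at degree
`n`: `B_{f,n}(x) = Σ_{r: Σ r_i ≤ n} f(r/n) · n!/(r_1!⋯r_k!(n−Σr_i)!) · Π x_i^{r_i} ·
(1−Σ x_i)^{n−Σ r_i}`. -/
noncomputable def simplexBernstein (k : ℕ) (f : (Fin k → ℝ) → ℝ) (n : ℕ)
    (x : Fin k → ℝ) : ℝ :=
  ∑ r ∈ (Finset.Icc (0 : Fin k → ℕ) (fun _ => n)).filter (fun r => ∑ i, r i ≤ n),
    f (fun i => (r i : ℝ) / (n : ℝ)) *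
      ((n.factorial : ℝ) /
        ((∏ i, ((r i).factorial : ℝ)) * (((n - ∑ i, r i).factorial : ℕ) : ℝ))) *
      (∏ i, x i ^ (r i)) * (1 - ∑ i, x i) ^ (n - ∑ i, r i)

namespace SimplexBernsteinAux

/-- The index set. -/
def idx (k n : ℕ) : Finset (Fin k → ℕ) :=
  (Finset.Icc (0 : Fin k → ℕ) (fun _ => n)).filter (fun r => ∑ i, r i ≤ n)

/-- The multinomial coefficient. -/
noncomputable def coef (k n : ℕ) (r : Fin k → ℕ) : ℝ :=
  (n.factorial : ℝ) / ((∏ i, ((r i).factorial : ℝ)) * (((n - ∑ i, r i).factorial : ℕ) : ℝ))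

lemma mem_idx {k n : ℕ} {r : Fin k → ℕ} : r ∈ idx k n ↔ ∑ i, r i ≤ n := by
  simp only [idx, Finset.mem_filter, Finset.mem_Icc, and_iff_right_iff_imp]
  intro h
  refine ⟨fun i => Nat.zero_le _, fun i => ?_⟩
  exact (Finset.single_le_sum (f := r) (fun j _ => Nat.zero_le _) (Finset.mem_univ i)).trans h

lemma coef_nonneg (k n : ℕ) (r : Fin k → ℕ) : 0 ≤ coef k n r := by
  unfold coef; positivity

lemma multinom (k n : ℕ) (y : Fin k → ℝ) (z : ℝ) :
    ∑ r ∈ idx k n, coef k n r * (∏ i, y i ^ r i) * z ^ (n - ∑ i, r i) = (z + ∑ i, y i) ^ n := by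
  have h := Finset.sum_pow_eq_sum_piAntidiag (Finset.univ : Finset (Fin (k + 1)))
    (Fin.cons z y : Fin (k + 1) → ℝ) n
  rw [Fin.sum_univ_succ] at h
  simp only [Fin.cons_zero, Fin.cons_succ] at h
  rw [h]
  refine Finset.sum_bij' (fun r _ => (Fin.cons (n - ∑ i, r i) r : Fin (k + 1) → ℕ))
    (fun s _ => fun i => s i.succ) ?_ ?_ ?_ ?_ ?_
  · intro r hr
    rw [mem_idx] at hr
    simp [Finset.mem_piAntidiag, Fin.sum_univ_succ, hr]
  · intro s hs
    rw [mem_idx]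
    simp [Finset.mem_piAntidiag, Fin.sum_univ_succ] at hs
    omega
  · intro r hr
    simp
  · intro s hs
    simp [Finset.mem_piAntidiag, Fin.sum_univ_succ] at hs
    ext i
    refine Fin.cases ?_ (fun j => ?_) i
    · simp; omega
    · simp
  · intro r hr
    rw [mem_idx] at hr
    have h2 := Nat.multinomial_spec (Finset.univ : Finset (Fin (k + 1)))
      (Fin.cons (n - ∑ i, r i) r : Fin (k + 1) → ℕ)
    rw [Fin.sum_univ_succ, Fin.prod_univ_succ] at h2
    simp only [Fin.cons_zero, Fin.cons_succ] at h2
    rw [Nat.sub_add_cancel hr] at h2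
    have h3 : coef k n r = (Nat.multinomial (Finset.univ : Finset (Fin (k + 1)))
      (Fin.cons (n - ∑ i, r i) r : Fin (k + 1) → ℕ) : ℝ) := by
      unfold coef
      rw [div_eq_iff (by positivity), ← h2]
      push_cast
      ring
    rw [h3, Fin.prod_univ_succ]
    simp only [Fin.cons_zero, Fin.cons_succ]
    ring

lemma moments {ι : Type*} (S : Finset ι) (w : ι → ℝ) (e : ι → ℕ) (a : ℝ) (n : ℕ)
    (h : ∀ t : ℝ, ∑ r ∈ S, w r * t ^ e r = (1 - a + t * a) ^ n) :
    ∑ r ∈ S, w r * ((e r : ℝ) - n * a) ^ 2 = n * a * (1 - a) := by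
  have hl (t : ℝ) : HasDerivAt (fun t : ℝ => 1 - a + t * a) a t := by
    simpa using ((hasDerivAt_id t).mul_const a).const_add (1 - a)
  have h1 (t : ℝ) : ∑ r ∈ S, w r * (e r * t ^ (e r - 1)) = n * (1 - a + t * a) ^ (n - 1) * a := by
    have d1 : HasDerivAt (fun t : ℝ => ∑ r ∈ S, w r * t ^ e r)
        (∑ r ∈ S, w r * (e r * t ^ (e r - 1))) t :=
      HasDerivAt.fun_sum fun r _ => (hasDerivAt_pow (e r) t).const_mul (w r)
    have d2 := (hl t).fun_pow n
    rw [funext h] at d1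
    exact d1.unique d2
  have h2 : ∑ r ∈ S, w r * (e r * ((e r - 1 : ℕ) : ℝ)) = n * ((n - 1 : ℕ) : ℝ) * a * a := by
    have d1 : HasDerivAt (fun t : ℝ => ∑ r ∈ S, w r * (e r * t ^ (e r - 1)))
        (∑ r ∈ S, w r * (e r * (((e r - 1 : ℕ) : ℝ) * 1 ^ (e r - 1 - 1)))) 1 :=
      HasDerivAt.fun_sum fun r _ =>
        ((hasDerivAt_pow (e r - 1) (1 : ℝ)).const_mul (e r : ℝ)).const_mul (w r)
    have d2 := (((hl 1).fun_pow (n - 1)).const_mul (n : ℝ)).mul_const a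
    rw [funext h1] at d1
    have := d1.unique d2
    simp at this
    rw [this]; ring
  have hc (m : ℕ) : (m : ℝ) * ((m - 1 : ℕ) : ℝ) = m * (m - 1) := by
    cases m <;> simp
  have h0 := h 1
  have h1' := h1 1
  simp only [one_pow, mul_one, one_mul, sub_add_cancel] at h0 h1'
  simp only [hc] at h2
  have : ∀ r ∈ S, w r * ((e r : ℝ) - n * a) ^ 2 = w r * (e r * (e r - 1)) +
      (1 - 2 * n * a) * (w r * e r) + (n * a) ^ 2 * w r := fun r _ => by ring
  rw [Finset.sum_congr rfl this, Finset.sum_add_distrib, Finset.sum_add_distrib,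
    ← Finset.mul_sum, ← Finset.mul_sum, h0, h1', h2]
  ring

/-- The weights. -/
noncomputable def wt (k n : ℕ) (x : Fin k → ℝ) (r : Fin k → ℕ) : ℝ :=
  coef k n r * (∏ i, x i ^ r i) * (1 - ∑ i, x i) ^ (n - ∑ i, r i)

lemma wt_sum (k n : ℕ) (x : Fin k → ℝ) : ∑ r ∈ idx k n, wt k n x r = 1 := by
  simp [wt, multinom]

lemma wt_var (k n : ℕ) (x : Fin k → ℝ) (j : Fin k) :
    ∑ r ∈ idx k n, wt k n x r * ((r j : ℝ) - n * x j) ^ 2 = n * x j * (1 - x j) := by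
  refine moments (idx k n) (wt k n x) (fun r => r j) (x j) n fun t => ?_
  have h := multinom k n (fun i => x i * (if i = j then t else 1)) (1 - ∑ i, x i)
  have e : (1 - ∑ i, x i + ∑ i, x i * (if i = j then t else 1)) = 1 - x j + t * x j := by
    have : ∀ i, x i * (if i = j then t else 1) = x i + (if i = j then x i * (t - 1) else 0) := by
      intro i; split_ifs <;> ring
    simp only [this, Finset.sum_add_distrib, Finset.sum_ite_eq', Finset.mem_univ, if_true]
    ring
  rw [e] at h
  rw [← h]
  refine Finset.sum_congr rfl fun r _ => ?_
  have : ∏ i, (x i * (if i = j then t else 1)) ^ r i = (∏ i, x i ^ r i) * t ^ r j := by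
    simp only [mul_pow, Finset.prod_mul_distrib, ite_pow, one_pow, Finset.prod_ite_eq',
      Finset.mem_univ, if_true]
  rw [this, wt]; ring

lemma eq_sum (k : ℕ) (f : (Fin k → ℝ) → ℝ) (n : ℕ) (x : Fin k → ℝ) :
    simplexBernstein k f n x = ∑ r ∈ idx k n, wt k n x r * f (fun i => (r i : ℝ) / n) := by
  unfold simplexBernstein idx wt coef
  exact Finset.sum_congr rfl fun r _ => by ring

lemma compact (k : ℕ) : IsCompact {x : Fin k → ℝ | (∀ i, 0 ≤ x i) ∧ ∑ i, x i ≤ 1} := by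
  refine (isCompact_Icc (a := (0 : Fin k → ℝ)) (b := 1)).of_isClosed_subset ?_ ?_
  · refine IsClosed.inter (s₁ := {x : Fin k → ℝ | ∀ i, 0 ≤ x i})
      (s₂ := {x : Fin k → ℝ | ∑ i, x i ≤ 1}) ?_ ?_
    · simp only [Set.ofPred_forall]
      exact isClosed_iInter fun i => isClosed_le continuous_const (continuous_apply i)
    · exact isClosed_le (by fun_prop) continuous_const
  · rintro x ⟨h1, h2⟩
    exact ⟨h1, fun i => (Finset.single_le_sum (fun j _ => h1 j) (Finset.mem_univ i)).trans h2⟩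

end SimplexBernsteinAux

open SimplexBernsteinAux

/-- Bernstein polynomial convergence on the simplex: if `Δ` is the `k`-dimensional simplex
`{x : x_i ≥ 0, Σ x_i ≤ 1}` and `f : Δ → ℝ` is continuous, then for every `x ∈ Δ`,
`B_{f,n}(x) → f(x)` as `n → ∞`. -/
theorem simplexBernstein_pointwise_convergence
    (k : ℕ) (hk : 1 ≤ k)
    (Δ : Set (Fin k → ℝ)) (hΔ : Δ = {x | (∀ i, 0 ≤ x i) ∧ ∑ i, x i ≤ 1})
    (f : (Fin k → ℝ) → ℝ) (hf : ContinuousOn f Δ) :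
    ∀ x ∈ Δ, Filter.Tendsto (fun n : ℕ => simplexBernstein k f n x)
      Filter.atTop (nhds (f x)) := by
  subst hΔ
  intro x hx
  obtain ⟨M, hM⟩ := (compact k).exists_bound_of_continuousOn hf
  have hM0 : 0 ≤ M := (norm_nonneg _).trans (hM x hx)
  rw [Metric.tendsto_atTop]
  intro ε hε
  obtain ⟨δ, hδ, hd⟩ := Metric.continuousOn_iff.1 hf x hx (ε / 2) (by positivity)
  obtain ⟨N, hN⟩ := exists_nat_gt (2 * M / δ ^ 2 * k / (ε / 2))
  refine ⟨N + 1, fun n hn => ?_⟩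
  have hn0 : (0 : ℝ) < n := by exact_mod_cast (by omega : 0 < n)
  have hNn : (N : ℝ) ≤ n := by exact_mod_cast (by omega : N ≤ n)
  have hw : ∀ r, 0 ≤ wt k n x r := fun r =>
    mul_nonneg (mul_nonneg (coef_nonneg k n r)
      (Finset.prod_nonneg fun i _ => pow_nonneg (hx.1 i) _))
      (pow_nonneg (sub_nonneg.2 hx.2) _)
  have key : ∀ r ∈ idx k n, |f (fun i => (r i : ℝ) / n) - f x| ≤
      ε / 2 + 2 * M / δ ^ 2 * ∑ j, ((r j : ℝ) - n * x j) ^ 2 / n ^ 2 := by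
    intro r hr
    rw [mem_idx] at hr
    have hy : (fun i => (r i : ℝ) / n) ∈ {x : Fin k → ℝ | (∀ i, 0 ≤ x i) ∧ ∑ i, x i ≤ 1} := by
      refine ⟨fun i => by positivity, ?_⟩
      rw [← Finset.sum_div, div_le_one hn0]
      exact_mod_cast hr
    have hs0 : 0 ≤ ∑ j, ((r j : ℝ) - n * x j) ^ 2 / (n : ℝ) ^ 2 :=
      Finset.sum_nonneg fun j _ => by positivity
    by_cases hc : dist (fun i => (r i : ℝ) / n) x < δ
    · have := hd _ hy hc
      rw [Real.dist_eq] at this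
      have : 0 ≤ 2 * M / δ ^ 2 * ∑ j, ((r j : ℝ) - n * x j) ^ 2 / n ^ 2 := by positivity
      linarith
    · rw [dist_pi_lt_iff hδ] at hc
      push Not at hc
      obtain ⟨j, hj⟩ := hc
      rw [Real.dist_eq] at hj
      have h1 : δ ^ 2 ≤ ∑ j, ((r j : ℝ) - n * x j) ^ 2 / (n : ℝ) ^ 2 := by
        calc δ ^ 2 ≤ |(r j : ℝ) / n - x j| ^ 2 := by gcongr
          _ = ((r j : ℝ) - n * x j) ^ 2 / (n : ℝ) ^ 2 := by
            rw [sq_abs]; field_simp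
          _ ≤ _ := Finset.single_le_sum
            (f := fun j => ((r j : ℝ) - n * x j) ^ 2 / (n : ℝ) ^ 2)
            (fun j _ => by positivity) (Finset.mem_univ j)
      have h2 : 2 * M ≤ 2 * M / δ ^ 2 * ∑ j, ((r j : ℝ) - n * x j) ^ 2 / n ^ 2 := by
        calc 2 * M = 2 * M / δ ^ 2 * δ ^ 2 := by field_simp
          _ ≤ _ := by gcongr
      have h3 := hM _ hy
      have h4 := hM x hx
      rw [Real.norm_eq_abs] at h3 h4
      have h5 := abs_sub (f (fun i => (r i : ℝ) / n)) (f x)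
      linarith
  have hdiff : simplexBernstein k f n x - f x =
      ∑ r ∈ idx k n, wt k n x r * (f (fun i => (r i : ℝ) / n) - f x) := by
    simp only [mul_sub, Finset.sum_sub_distrib, ← Finset.sum_mul, wt_sum, one_mul, eq_sum]
  have hvar : ∑ r ∈ idx k n, wt k n x r *
      (ε / 2 + 2 * M / δ ^ 2 * ∑ j, ((r j : ℝ) - n * x j) ^ 2 / n ^ 2) =
      ε / 2 + 2 * M / δ ^ 2 * ∑ j, (n * x j * (1 - x j)) / n ^ 2 := by
    simp only [mul_add, Finset.sum_add_distrib, ← Finset.sum_mul, wt_sum, one_mul]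
    congr 1
    simp only [← wt_var k n x, Finset.mul_sum, Finset.sum_div]
    rw [Finset.sum_comm]
    exact Finset.sum_congr rfl fun j _ => Finset.sum_congr rfl fun r _ => by ring
  have hb : ∑ j, (n * x j * (1 - x j)) / (n : ℝ) ^ 2 ≤ (k : ℝ) / n := by
    calc _ ≤ ∑ _j : Fin k, 1 / (n : ℝ) := by
          refine Finset.sum_le_sum fun j _ => ?_
          rw [div_le_div_iff₀ (by positivity) hn0]
          have : x j * (1 - x j) ≤ 1 := by nlinarith [sq_nonneg (x j - 1 / 2)]
          nlinarith [mul_le_mul_of_nonneg_left this (sq_nonneg (n : ℝ))]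
      _ = k / n := by simp [div_eq_mul_inv]
  rw [Real.dist_eq, hdiff]
  calc _ ≤ ∑ r ∈ idx k n, |wt k n x r * (f (fun i => (r i : ℝ) / n) - f x)| :=
        Finset.abs_sum_le_sum_abs _ _
    _ ≤ ∑ r ∈ idx k n, wt k n x r *
      (ε / 2 + 2 * M / δ ^ 2 * ∑ j, ((r j : ℝ) - n * x j) ^ 2 / n ^ 2) := by
        refine Finset.sum_le_sum fun r hr => ?_
        rw [abs_mul, abs_of_nonneg (hw r)]
        exact mul_le_mul_of_nonneg_left (key r hr) (hw r)
    _ ≤ ε / 2 + 2 * M / δ ^ 2 * (k / n) := by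
        rw [hvar]; gcongr
    _ < ε / 2 + ε / 2 := by
        gcongr
        rw [← mul_div_assoc, div_lt_iff₀ hn0]
        rw [div_lt_iff₀ (by positivity)] at hN
        nlinarith
    _ = ε := by ring
end

section
/- Let T ≥ 3 be an integer and let a, b be reals with 0 ≤ a ≤ 1 and b ≥ −a. Let M be the symmetric T×T real matrix with entries M_{ii} = −2 for i = 1,…,T−1, M_{TT} = −2−b, M_{i,i+1} = M_{i+1,i} = 1 for i = 1,…,T−1, M_{1T} = M_{T1} = 1−a, and all other entries 0. Then M is negative semidefinite. -/
/-- The Hessian of the non-uniform-valuation revenue objective: the symmetric `T×T` real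
matrix with `M_{ii} = −2` for `i = 1,…,T−1`, `M_{TT} = −2−b`, `M_{i,i+1} = M_{i+1,i} = 1`,
`M_{1T} = M_{T1} = 1−a`, and all other entries `0` (indices `0,…,T−1` standing for
`1,…,T`, so index `T−1` stands for `T`). -/
noncomputable def nonUniformHessian (T : ℕ) (a b : ℝ) : Matrix (Fin T) (Fin T) ℝ :=
  fun i j =>
    if i = j then (if i.val = T - 1 then -2 - b else -2)
    else if i.val + 1 = j.val ∨ j.val + 1 = i.val then 1
    else if (i.val = 0 ∧ j.val = T - 1) ∨ (i.val = T - 1 ∧ j.val = 0) then 1 - a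
    else 0

lemma nUH_symm (T : ℕ) (a b : ℝ) (i j : Fin T) :
    nonUniformHessian T a b i j = nonUniformHessian T a b j i := by
  unfold nonUniformHessian
  by_cases h : i = j
  · subst h; rfl
  · have h' : ¬ j = i := fun e => h e.symm
    simp only [h, h', if_false]
    congr 1
    · exact propext or_comm
    · congr 1
      apply propext
      tauto

lemma nUH_offdiag (T : ℕ) (a b : ℝ) (ha1 : a ≤ 1) (i j : Fin T) (h : i ≠ j) :
    0 ≤ nonUniformHessian T a b i j := by
  unfold nonUniformHessian
  simp only [h, if_false]
  split_ifs <;> linarith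

lemma nUH_three (T : ℕ) (p q r : Fin T) (u v w : ℝ) (f : Fin T → ℝ)
    (h : ∀ j, f j = (if j = p then u else 0) + (if j = q then v else 0)
      + (if j = r then w else 0)) : ∑ j, f j = u + v + w := by
  simp [h, Finset.sum_add_distrib]

lemma nUH_row (T : ℕ) (hT : 3 ≤ T) (a b : ℝ) (ha0 : 0 ≤ a) (hb : -a ≤ b) (i : Fin T) :
    ∑ j, nonUniformHessian T a b i j ≤ 0 := by
  obtain ⟨i, hi⟩ := i
  by_cases h0 : i = 0
  · rw [nUH_three T ⟨0, by omega⟩ ⟨1, by omega⟩ ⟨T - 1, by omega⟩ (-2) 1 (1 - a)]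
    · linarith
    · rintro ⟨j, hj⟩
      simp only [nonUniformHessian, Fin.mk.injEq]
      split_ifs <;> first | omega | norm_num
  by_cases h1 : i = T - 1
  · rw [nUH_three T ⟨T - 1, by omega⟩ ⟨T - 2, by omega⟩ ⟨0, by omega⟩ (-2 - b) 1 (1 - a)]
    · linarith
    · rintro ⟨j, hj⟩
      simp only [nonUniformHessian, Fin.mk.injEq]
      split_ifs <;> first | omega | norm_num
  · rw [nUH_three T ⟨i, by omega⟩ ⟨i - 1, by omega⟩ ⟨i + 1, by omega⟩ (-2) 1 1]
    · linarith
    · rintro ⟨j, hj⟩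
      simp only [nonUniformHessian, Fin.mk.injEq]
      split_ifs <;> first | omega | norm_num

/-- Let `T ≥ 3` and let `a, b` be reals with `0 ≤ a ≤ 1` and `b ≥ −a`.  Then the matrix
`M` above is negative semidefinite. -/
theorem nonUniformHessian_neg_semidef
    (T : ℕ) (hT : 3 ≤ T) (a b : ℝ) (ha0 : 0 ≤ a) (ha1 : a ≤ 1) (hb : -a ≤ b) :
    (-(nonUniformHessian T a b)).PosSemidef := by
  apply Matrix.PosSemidef.of_dotProduct_mulVec_nonneg
  · ext i j
    simp [nUH_symm T a b j i]
  · intro x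
    set M := nonUniformHessian T a b with hM
    have e : star x ⬝ᵥ (-M).mulVec x = ∑ i, ∑ j, -(M i j * (x i * x j)) := by
      simp only [dotProduct, Matrix.mulVec, Finset.mul_sum]
      refine Finset.sum_congr rfl fun i _ => Finset.sum_congr rfl fun j _ => ?_
      simp; ring
    have l : ∑ i, ∑ j, -(M i j * ((x i ^ 2 + x j ^ 2) / 2)) ≤
        ∑ i, ∑ j, -(M i j * (x i * x j)) := by
      refine Finset.sum_le_sum fun i _ => Finset.sum_le_sum fun j _ => ?_
      by_cases h : i = j
      · subst h; apply le_of_eq; ring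
      · have := nUH_offdiag T a b ha1 i j h
        nlinarith [mul_nonneg this (sq_nonneg (x i - x j))]
    have r : ∑ i, ∑ j, -(M i j * ((x i ^ 2 + x j ^ 2) / 2)) =
        ∑ i, x i ^ 2 * (-∑ j, M i j) := by
      have s : ∑ i, ∑ j, M i j * x j ^ 2 = ∑ i, ∑ j, M i j * x i ^ 2 := by
        rw [Finset.sum_comm]
        refine Finset.sum_congr rfl fun i _ => Finset.sum_congr rfl fun j _ => ?_
        rw [hM, nUH_symm]
      have t : ∑ i, ∑ j, -(M i j * ((x i ^ 2 + x j ^ 2) / 2)) =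
          -(1/2) * (∑ i, ∑ j, M i j * x i ^ 2) + -(1/2) * (∑ i, ∑ j, M i j * x j ^ 2) := by
        simp only [Finset.mul_sum, ← Finset.sum_add_distrib]
        refine Finset.sum_congr rfl fun i _ => Finset.sum_congr rfl fun j _ => ?_
        ring
      have u : ∑ i, x i ^ 2 * (-∑ j, M i j) = - ∑ i, ∑ j, M i j * x i ^ 2 := by
        rw [← Finset.sum_neg_distrib]
        refine Finset.sum_congr rfl fun i _ => ?_
        rw [← Finset.sum_mul]; ring
      rw [t, s, u]; ring
    rw [e]
    refine le_trans ?_ l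
    rw [r]
    refine Finset.sum_nonneg fun i _ => mul_nonneg (sq_nonneg _) ?_
    have := nUH_row T hT a b ha0 hb i
    linarith
end

section
/- Let m ≥ 1 and T ≥ 2 be integers, let S be a symmetric positive semidefinite m×m real matrix, and let A be a diagonal m×m real matrix with nonnegative diagonal entries such that S − A is positive semidefinite. Then for all vectors x_1,…,x_T ∈ ℝ^m: Σ_{i=1}^{T−1} x_iᵀ S x_{i+1} + x_1ᵀ (S − A) x_T ≤ Σ_{i=1}^{T} x_iᵀ S x_i. -/
open Matrix

lemma psd_amgm {m : ℕ} {S : Matrix (Fin m) (Fin m) ℝ} (hS : S.PosSemidef) (x y : Fin m → ℝ) :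
    x ⬝ᵥ (S *ᵥ y) ≤ (x ⬝ᵥ (S *ᵥ x) + y ⬝ᵥ (S *ᵥ y)) / 2 := by
  have h := hS.dotProduct_mulVec_nonneg (x - y)
  have hT : Sᵀ = S := by simpa using hS.isHermitian.eq
  have hs : y ⬝ᵥ (S *ᵥ x) = x ⬝ᵥ (S *ᵥ y) := by
    rw [dotProduct_mulVec, ← mulVec_transpose, hT, dotProduct_comm]
  simp only [star_trivial, mulVec_sub, sub_dotProduct, dotProduct_sub] at h
  linarith

lemma psd_chain {m : ℕ} {S : Matrix (Fin m) (Fin m) ℝ} (hS : S.PosSemidef)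
    (x : ℕ → Fin m → ℝ) (n : ℕ) :
    (∑ i ∈ Finset.Icc 1 n, x i ⬝ᵥ (S *ᵥ x (i + 1)))
      ≤ (∑ i ∈ Finset.Icc 1 (n + 1), x i ⬝ᵥ (S *ᵥ x i))
        - (x 1 ⬝ᵥ (S *ᵥ x 1) + x (n + 1) ⬝ᵥ (S *ᵥ x (n + 1))) / 2 := by
  induction n with
  | zero => simp
  | succ k ih =>
    rw [Finset.sum_Icc_succ_top (by omega), Finset.sum_Icc_succ_top (b := k + 1) (by omega)]
    have := psd_amgm hS (x (k + 1)) (x (k + 1 + 1))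
    linarith

/-- Let `m ≥ 1` and `T ≥ 2` be integers, `S` a symmetric positive semidefinite `m×m` real
matrix, and `A = diag(α)` with nonnegative diagonal entries such that `S − A` is positive
semidefinite.  Then for all vectors `x_1,…,x_T ∈ ℝ^m`:
`Σ_{i=1}^{T−1} x_iᵀ S x_{i+1} + x_1ᵀ (S − A) x_T ≤ Σ_{i=1}^{T} x_iᵀ S x_i`. -/
theorem price_discrimination_hessian_inequality
    (m T : ℕ) (hm : 1 ≤ m) (hT : 2 ≤ T)
    (S : Matrix (Fin m) (Fin m) ℝ) (hS : S.PosSemidef)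
    (α : Fin m → ℝ) (hα : ∀ i, 0 ≤ α i)
    (A : Matrix (Fin m) (Fin m) ℝ) (hA : A = Matrix.diagonal α)
    (hSA : (S - A).PosSemidef) :
    ∀ x : ℕ → Fin m → ℝ,
      (∑ i ∈ Finset.Icc 1 (T - 1), x i ⬝ᵥ (S *ᵥ x (i + 1)))
          + x 1 ⬝ᵥ ((S - A) *ᵥ x T)
        ≤ ∑ i ∈ Finset.Icc 1 T, x i ⬝ᵥ (S *ᵥ x i) := by
  intro x
  obtain ⟨n, rfl⟩ : ∃ n, T = n + 1 := ⟨T - 1, by omega⟩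
  have h1 := psd_chain hS x n
  have h2 := psd_amgm hSA (x 1) (x (n + 1))
  have h3 : ∀ y : Fin m → ℝ, y ⬝ᵥ ((S - A) *ᵥ y) ≤ y ⬝ᵥ (S *ᵥ y) := by
    intro y
    have h := (PosSemidef.diagonal (n := Fin m) (d := α) hα).dotProduct_mulVec_nonneg y
    rw [← hA] at h
    simp only [star_trivial] at h
    rw [sub_mulVec, dotProduct_sub]
    linarith
  have h4 := h3 (x 1)
  have h5 := h3 (x (n + 1))
  simp only [Nat.add_sub_cancel]
  linarith
end

section
/- Let g be a real with 0 ≤ g ≤ (3 + √13)/2. Define v_2(p) = (2p + g)/(1 + g) and R_g(p) = p·(1 − v_2(p)) + (1/4)·(v_2(p) + g(1 − v_2(p)))² for p ∈ ℝ. Then R_g attains its global maximum over ℝ at p* = (1 + 3g − 2g²)/(2(1 + 4g − g²)), and R_g(p*) = (1 + 4g)/(4(1 + 4g − g²)). -/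
/-- Non-committed two-round pricing with uniform externality `g ∈ [0, (3+√13)/2]`:
with `v₂(p) = (2p + g)/(1 + g)` and
`R_g(p) = p·(1 − v₂(p)) + (1/4)·(v₂(p) + g(1 − v₂(p)))²`, the function `R_g` attains its
global maximum over ℝ at `p* = (1 + 3g − 2g²)/(2(1 + 4g − g²))`, and
`R_g(p*) = (1 + 4g)/(4(1 + 4g − g²))`. -/
theorem noncommitted_optimal_first_round_price
    (g : ℝ) (hg0 : 0 ≤ g) (hg1 : g ≤ (3 + Real.sqrt 13) / 2)
    (v2 : ℝ → ℝ) (hv2 : ∀ p, v2 p = (2 * p + g) / (1 + g))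
    (R : ℝ → ℝ) (hR : ∀ p, R p = p * (1 - v2 p) + (1 / 4) * (v2 p + g * (1 - v2 p)) ^ 2)
    (pstar : ℝ) (hpstar : pstar = (1 + 3 * g - 2 * g ^ 2) / (2 * (1 + 4 * g - g ^ 2))) :
    (∀ p : ℝ, R p ≤ R pstar) ∧
    R pstar = (1 + 4 * g) / (4 * (1 + 4 * g - g ^ 2)) := by
  have h4 : Real.sqrt 13 ≤ 4 := by
    rw [Real.sqrt_le_left (by norm_num)]
    norm_num
  have hD : 0 < 1 + 4 * g - g ^ 2 := by nlinarith
  have hg : 0 < 1 + g := by linarith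
  have key : ∀ p, R p = (1 + 4 * g) / (4 * (1 + 4 * g - g ^ 2))
      - (1 + 4 * g - g ^ 2) * (p - pstar) ^ 2 / (1 + g) ^ 2 := by
    intro p
    rw [hR, hv2, hpstar]
    have hD' := hD.ne'
    have hg' := hg.ne'
    generalize hE : 1 + 4 * g - g ^ 2 = D at *
    field_simp
    subst hE
    ring
  have hs : R pstar = (1 + 4 * g) / (4 * (1 + 4 * g - g ^ 2)) := by
    rw [key]; simp
  refine ⟨fun p => ?_, hs⟩
  rw [hs, key p]
  have : 0 ≤ (1 + 4 * g - g ^ 2) * (p - pstar) ^ 2 / (1 + g) ^ 2 := by positivity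
  linarith
end

section
/- Let g be a real with 0 ≤ g ≤ (3 + √13)/2 and set p* = (1 + 3g − 2g²)/(2(1 + 4g − g²)). Then p* ≤ 1/2 and (2p* + g)/(2(1 + g)) ≥ p*. Consequently, the non-committed equilibrium price path is non-decreasing: the second-round price p_1(H²) = (g/2)|H²| + (2p* + g)/(2(1+g)) is at least the first-round price p* for every number |H²| ≥ 0 of first-round buyers. -/
/-- Let `0 ≤ g ≤ (3 + √13)/2` and `p* = (1 + 3g − 2g²)/(2(1 + 4g − g²))`, the optimal
first-round price of a non-committed monopolist.  Then `p* ≤ 1/2` and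
`(2p* + g)/(2(1 + g)) ≥ p*`; consequently the non-committed equilibrium price path is
non-decreasing: the second-round price `p₁(H²) = (g/2)|H²| + (2p* + g)/(2(1+g))` is at
least `p*` for every number `|H²| ≥ 0` of first-round buyers. -/
theorem noncommitted_price_path_nondecreasing
    (g : ℝ) (hg0 : 0 ≤ g) (hg1 : g ≤ (3 + Real.sqrt 13) / 2)
    (pstar : ℝ) (hpstar : pstar = (1 + 3 * g - 2 * g ^ 2) / (2 * (1 + 4 * g - g ^ 2))) :
    pstar ≤ 1 / 2 ∧
    pstar ≤ (2 * pstar + g) / (2 * (1 + g)) ∧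
    (∀ k : ℕ, pstar ≤ (g / 2) * k + (2 * pstar + g) / (2 * (1 + g))) := by
  have hs : Real.sqrt 13 ^ 2 = 13 := Real.sq_sqrt (by norm_num)
  have hs3 : 3 ≤ Real.sqrt 13 := Real.le_sqrt_of_sq_le (by norm_num)
  have hq : 0 ≤ 1 + 3 * g - g ^ 2 := by
    have h := mul_nonneg (sub_nonneg.mpr hg1)
      (show 0 ≤ g + (Real.sqrt 13 - 3) / 2 by linarith)
    nlinarith
  have hD : 0 < 1 + 4 * g - g ^ 2 := by
    rcases hg0.eq_or_lt with h | h
    · rw [← h]; norm_num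
    · linarith
  have h1 : pstar ≤ 1 / 2 := by
    rw [hpstar, div_le_div_iff₀ (by linarith) (by norm_num)]
    nlinarith [sq_nonneg g]
  have h2 : pstar ≤ (2 * pstar + g) / (2 * (1 + g)) := by
    rw [le_div_iff₀ (by linarith)]
    nlinarith [mul_nonneg hg0 (sub_nonneg.mpr h1)]
  refine ⟨h1, h2, fun k => ?_⟩
  have h3 : 0 ≤ (g / 2) * (k : ℝ) := by positivity
  linarith
end

section
/- Let T ≥ 1 be an integer and g ∈ [0,1). For p = (p_T,…,p_1) ∈ ℝ^T define recursively v_{T+1} = 1 and v_t = p_t − g(1 − v_{t+1}) for t = T, T−1, …, 1, and set f(p) = Σ_{t=1}^T p_t (v_{t+1} − v_t). Then for every p ∈ ℝ^T satisfying the monotonicity constraints p_T ≤ p_{T−1} ≤ … ≤ p_1, one has f(p) ≤ f(½,…,½) = (1/4)·(1 − g^T)/(1 − g) = (1/4)·Σ_{t=0}^{T−1} g^t; i.e., the constant price sequence p_t = 1/2 maximizes f over non-decreasing price paths. -/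
/-- The equilibrium purchase thresholds in the model with future-dependent externality,
defined by downward recursion from `v_{T+1} = 1` via `v_t = p_t − g(1 − v_{t+1})`:
`futureThresh g T p s` equals `v_{T+1−s}`, i.e., `v t = futureThresh g T p (T+1−t)`. -/
noncomputable def futureThresh (g : ℝ) (T : ℕ) (p : ℕ → ℝ) : ℕ → ℝ
  | 0 => 1
  | s + 1 => p (T - s) - g * (1 - futureThresh g T p s)

/-- The normalized limiting revenue `f(p) = Σ_{t=1}^T p_t (v_{t+1} − v_t)` in the
future-dependent externality model, with `v t = futureThresh g T p (T+1−t)`. -/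
noncomputable def futureRevenue (g : ℝ) (T : ℕ) (p : ℕ → ℝ) : ℝ :=
  ∑ t ∈ Finset.Icc 1 T,
    p t * (futureThresh g T p (T - t) - futureThresh g T p (T + 1 - t))

/-- Revenue as a sum over rounds in time order. -/
lemma futureRevenue_eq_range (g : ℝ) (T : ℕ) (p : ℕ → ℝ) :
    futureRevenue g T p = ∑ s ∈ Finset.range T,
      p (T - s) * (futureThresh g T p s - futureThresh g T p (s + 1)) := by
  unfold futureRevenue
  refine Finset.sum_nbij' (fun t => T - t) (fun s => T - s) ?_ ?_ ?_ ?_ ?_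
  · intro t ht; simp only [Finset.mem_Icc, Finset.mem_range] at *; omega
  · intro t ht; simp only [Finset.mem_Icc, Finset.mem_range] at *; omega
  · intro t ht; simp only [Finset.mem_Icc] at *; omega
  · intro t ht; simp only [Finset.mem_range] at *; omega
  · intro t ht
    simp only [Finset.mem_Icc] at ht
    have h1 : T - (T - t) = t := by omega
    have h2 : T - t + 1 = T + 1 - t := by omega
    rw [h1, h2]

/-- The linear (first-order) part of the deviation has the right sign. -/
lemma future_linear (g : ℝ) (hg0 : 0 ≤ g) (hg1 : g < 1) (T : ℕ) (p : ℕ → ℝ)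
    (hp : ∀ t : ℕ, 1 ≤ t → t < T → p (t + 1) ≤ p t) (s : ℕ) (hs : s < T) :
    (1 - g) * futureThresh g T p s + g - p (T - s) ≤ g ^ s * (1 - p (T - s)) := by
  induction s with
  | zero => simp [futureThresh]
  | succ s ih =>
    have ih := ih (by omega)
    have hm := hp (T - (s + 1)) (by omega) (by omega)
    have h1 : T - (s + 1) + 1 = T - s := by omega
    rw [h1] at hm
    have h2 : g ^ (s + 1) ≤ 1 := pow_le_one₀ hg0 hg1.le
    have h3 := mul_nonneg (sub_nonneg.2 hm) (sub_nonneg.2 h2)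
    have h4 := mul_le_mul_of_nonneg_left ih hg0
    rw [pow_succ] at *
    simp only [futureThresh]
    nlinarith

/-- Storage-function (dissipation) bound. -/
lemma future_bound (g : ℝ) (hg0 : 0 ≤ g) (hg1 : g < 1) (T : ℕ) (p : ℕ → ℝ)
    (hp : ∀ t : ℕ, 1 ≤ t → t < T → p (t + 1) ≤ p t) (n : ℕ) (hn : n ≤ T) :
    2 * (1 - g) * ∑ s ∈ Finset.range n,
      p (T - s) * (futureThresh g T p s - futureThresh g T p (s + 1)) ≤
    2 * (1 - g) * (1 / 4 * ∑ s ∈ Finset.range n, g ^ s) -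
      ((1 - g) * futureThresh g T p n + g - 1 / 2 - 1 / 2 * g ^ n) ^ 2 := by
  induction n with
  | zero => simp [futureThresh]; norm_num
  | succ s ih =>
    have ih := ih (by omega)
    have hl := future_linear g hg0 hg1 T p hp s (by omega)
    rw [Finset.sum_range_succ, Finset.sum_range_succ, pow_succ g s]
    simp only [futureThresh] at *
    generalize futureThresh g T p s = v at *
    generalize p (T - s) = q at *
    generalize g ^ s = a at *
    have hl2 := mul_nonneg (sub_nonneg.2 hg1.le) (sub_nonneg.2 hl)
    have hsq : 0 ≤ (1 - g) * (1 + g) *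
        ((q - 1 / 2) - ((1 - g) * v + g - 1 / 2 - 1 / 2 * a)) ^ 2 :=
      mul_nonneg (mul_nonneg (by linarith) (by linarith)) (sq_nonneg _)
    nlinarith

lemma future_const (g : ℝ) (T s : ℕ) :
    (1 - g) * futureThresh g T (fun _ => 1 / 2) s + g = 1 / 2 + 1 / 2 * g ^ s := by
  induction s with
  | zero => simp [futureThresh]; norm_num
  | succ s ih =>
    simp only [futureThresh, pow_succ]
    linear_combination g * ih

/-- Let `T ≥ 1` and `g ∈ [0,1)`.  For every price path `p` that is non-decreasing over
time (`p_T ≤ p_{T−1} ≤ … ≤ p_1`, with `p t` the price when `t` rounds remain), the revenue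
satisfies `f(p) ≤ f(½,…,½) = (1/4)(1 − g^T)/(1 − g) = (1/4)Σ_{t=0}^{T−1} g^t`; i.e., the
constant price `1/2` maximizes `f` over non-decreasing price paths. -/
theorem future_externality_optimal_constant_price
    (T : ℕ) (hT : 1 ≤ T) (g : ℝ) (hg0 : 0 ≤ g) (hg1 : g < 1) :
    (∀ p : ℕ → ℝ, (∀ t : ℕ, 1 ≤ t → t < T → p (t + 1) ≤ p t) →
      futureRevenue g T p ≤ (1 / 4) * ((1 - g ^ T) / (1 - g))) ∧
    futureRevenue g T (fun _ => 1 / 2) = (1 / 4) * ((1 - g ^ T) / (1 - g)) ∧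
    (1 / 4) * ((1 - g ^ T) / (1 - g)) = (1 / 4) * ∑ t ∈ Finset.range T, g ^ t := by
  have hgeom : (1 - g ^ T) / (1 - g) = ∑ t ∈ Finset.range T, g ^ t := by
    rw [div_eq_iff (by linarith), geom_sum_mul_neg]
  rw [hgeom]
  refine ⟨fun p hp => ?_, ?_, rfl⟩
  · rw [futureRevenue_eq_range]
    have h := future_bound g hg0 hg1 T p hp T le_rfl
    have h2 := le_trans h (sub_le_self _ (sq_nonneg _))
    exact le_of_mul_le_mul_left h2 (by linarith)
  · rw [futureRevenue_eq_range, Finset.mul_sum]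
    refine Finset.sum_congr rfl fun s _ => ?_
    simp only [futureThresh]
    linear_combination 1 / 2 * future_const g T s
end
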